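/- (Theorem 4, half-bit optimality of the EER-BR scheme, explicit-region form.) For all reals P1, P2 with 0 ≤ P1 ≤ P2 and all reals Pr1, Pr2 ≥ 0, and every tuple r = (R12, R21, R1r, R2r) in the outer-bound region \overline{C} = {(R12, R21, R1r, R2r) ∈ ℝ≥0⁴ : (R12, R21) ∈ C_bc(Pr1, Pr2) and (R12, R21, R1r, R2r) ∈ C_ma(P1, P2)}, there exists a tuple p in R_ts = {(R12, R21, R1r, R2r) ∈ ℝ≥0⁴ : (R12, R21) ∈ C_bc(Pr1, Pr2) and (R12, R21, R1r, R2r) ∈ R_ma(P1, P2)} such that r_i − 1/2 ≤ p_i ≤ r_i for each of the four coordinates i. -/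

import Mathlib

noncomputable def C (x : ℝ) : ℝ := (1/2) * Real.logb 2 (1 + x)
noncomputable def D (x : ℝ) : ℝ := (1/2) * max 0 (Real.logb 2 (1/2 + x))

def Cbc (Pr1 Pr2 : ℝ) : Set (ℝ × ℝ) :=
  {p | 0 ≤ p.1 ∧ 0 ≤ p.2 ∧ p.1 ≤ C Pr2 ∧ p.2 ≤ C Pr1}

def Cma (P1 P2 : ℝ) : Set (ℝ × ℝ × ℝ × ℝ) :=
  {r | 0 ≤ r.1 ∧ 0 ≤ r.2.1 ∧ 0 ≤ r.2.2.1 ∧ 0 ≤ r.2.2.2 ∧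
    r.2.2.1 + r.1 ≤ C P1 ∧ r.2.2.2 + r.2.1 ≤ C P2 ∧
    r.2.2.1 + r.2.2.2 + max r.1 r.2.1 ≤ C (P1 + P2)}

noncomputable def Rts' (P1 P2 α : ℝ) : Set (ℝ × ℝ) :=
  {p | 0 ≤ p.1 ∧ 0 ≤ p.2 ∧
    p.1 ≤ (1 - α) * C P1 ∧
    p.2 ≤ (1 - α) * C P2 + α * C ((P2 - P1) / (1 + 2*P1)) ∧
    p.1 + p.2 ≤ (1 - α) * C (P1 + P2) + α * C ((P2 - P1) / (1 + 2*P1))}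

noncomputable def Rma (P1 P2 : ℝ) : Set (ℝ × ℝ × ℝ × ℝ) :=
  {r | ∃ α R0 δ R1r R2r : ℝ, 0 ≤ α ∧ α ≤ 1 ∧ R0 = α * D P1 ∧
      (R1r, R2r) ∈ Rts' P1 P2 α ∧ 0 ≤ δ ∧ δ ≤ R2r ∧
      r = (R0, R0 + δ, R1r, R2r - δ)} ∪
  {r | ∃ α R0 δ R1r R2r : ℝ, 0 ≤ α ∧ α ≤ 1 ∧ R0 = α * D P1 ∧
      (R1r, R2r) ∈ Rts' P1 P2 α ∧ 0 ≤ δ ∧ δ ≤ R1r ∧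
      r = (R0 + δ, R0, R1r - δ, R2r)}

def Cbar (P1 P2 Pr1 Pr2 : ℝ) : Set (ℝ × ℝ × ℝ × ℝ) :=
  {r | (r.1, r.2.1) ∈ Cbc Pr1 Pr2 ∧ r ∈ Cma P1 P2}

noncomputable def Rts (P1 P2 Pr1 Pr2 : ℝ) : Set (ℝ × ℝ × ℝ × ℝ) :=
  {r | (r.1, r.2.1) ∈ Cbc Pr1 Pr2 ∧ r ∈ Rma P1 P2}

lemma C_mono_aux {x y : ℝ} (hx : 0 ≤ x) (h : x ≤ y) : C x ≤ C y := by
  unfold C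
  have : Real.logb 2 (1 + x) ≤ Real.logb 2 (1 + y) :=
    Real.logb_le_logb_of_le (by norm_num) (by linarith) (by linarith)
  linarith

lemma C_diff_aux {P1 P2 : ℝ} (h1 : 0 ≤ P1) (h2 : P1 ≤ P2) :
    C ((P2 - P1) / (1 + 2*P1)) = C (P1 + P2) - C (2*P1) := by
  unfold C
  have e : 1 + (P2 - P1) / (1 + 2*P1) = (1 + (P1 + P2)) / (1 + 2*P1) := by
    field_simp
    ring
  rw [e, Real.logb_div (ne_of_gt (by linarith)) (by positivity)]
  ring

lemma C_two_aux {P1 : ℝ} (h1 : 0 ≤ P1) :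
    C (2*P1) = 1/2 + (1/2) * Real.logb 2 (1/2 + P1) := by
  unfold C
  have e : 1 + 2*P1 = 2 * (1/2 + P1) := by ring
  rw [e, Real.logb_mul (by norm_num) (by positivity), Real.logb_self_eq_one (by norm_num)]
  ring

lemma D_eq_aux {P1 : ℝ} (h1 : 0 ≤ P1) (h : 1/2 < C (2*P1)) : D P1 = C (2*P1) - 1/2 := by
  have := C_two_aux h1
  unfold D
  rw [max_eq_right (by linarith)]
  linarith

theorem EER_BR_half_bit (P1 P2 Pr1 Pr2 : ℝ) (h1 : 0 ≤ P1) (h2 : P1 ≤ P2)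
    (hr1 : 0 ≤ Pr1) (hr2 : 0 ≤ Pr2)
    (r : ℝ × ℝ × ℝ × ℝ) (hr : r ∈ Cbar P1 P2 Pr1 Pr2) :
    ∃ p ∈ Rts P1 P2 Pr1 Pr2,
      r.1 - 1/2 ≤ p.1 ∧ p.1 ≤ r.1 ∧
      r.2.1 - 1/2 ≤ p.2.1 ∧ p.2.1 ≤ r.2.1 ∧
      r.2.2.1 - 1/2 ≤ p.2.2.1 ∧ p.2.2.1 ≤ r.2.2.1 ∧
      r.2.2.2 - 1/2 ≤ p.2.2.2 ∧ p.2.2.2 ≤ r.2.2.2 := by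
  obtain ⟨a, b, c, d⟩ := r
  obtain ⟨⟨-, -, ha2, hb2⟩, ha, hb, hc, hd, hac, hbd, hs⟩ := hr
  simp only at *
  have hsa : c + d + a ≤ C (P1 + P2) := by linarith [le_max_left a b]
  have hsb : c + d + b ≤ C (P1 + P2) := by linarith [le_max_right a b]
  have hK : C P1 ≤ C (2*P1) := C_mono_aux h1 (by linarith)
  have hS : C P2 ≤ C (P1 + P2) := C_mono_aux (by linarith) (by linarith)
  have he := C_diff_aux h1 h2
  -- the time-sharing parameter
  have key : ∀ m, 1/2 < m → m ≤ C P1 → ∃ α, 0 ≤ α ∧ α ≤ 1 ∧ m - 1/2 = α * D P1 ∧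
      C P1 - m + 1/2 - α/2 ≤ (1 - α) * C P1 ∧
      C P2 - m + 1/2 - α/2 ≤ (1 - α) * C P2 + α * C ((P2 - P1) / (1 + 2*P1)) ∧
      C (P1 + P2) - m + 1/2 - α/2 ≤
        (1 - α) * C (P1 + P2) + α * C ((P2 - P1) / (1 + 2*P1)) := by
    intro m hm hm1
    have hD := D_eq_aux h1 (by linarith)
    have hDpos : 0 < D P1 := by linarith
    have e1 : (m - 1/2) / D P1 * D P1 = m - 1/2 := by field_simp
    have g0 : 0 ≤ (m - 1/2) / D P1 := div_nonneg (by linarith) hDpos.le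
    have g1 : (m - 1/2) / D P1 ≤ 1 := by rw [div_le_one hDpos]; linarith
    generalize (m - 1/2) / D P1 = α at *
    have hK' : C (2*P1) = D P1 + 1/2 := by linarith
    refine ⟨α, g0, g1, e1.symm, ?_, ?_, ?_⟩
    · nlinarith
    · rw [he, hK']; nlinarith
    · rw [he, hK']; nlinarith
  rcases le_total a b with hab | hab
  · rcases le_or_gt a (1/2) with h | h
    · refine ⟨(0, b, c, d), ⟨⟨le_rfl, hb, by simp only; linarith, hb2⟩,
        Or.inl ⟨0, 0, b, c, d + b, le_rfl, zero_le_one, by simp,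
          ⟨hc, by simp only; linarith, ?_, ?_, ?_⟩, hb, by linarith, by simp⟩⟩, ?_⟩
      · simp only; linarith
      · simp only; linarith
      · simp only; linarith
      · refine ⟨?_, ?_, ?_, ?_, ?_, ?_, ?_, ?_⟩ <;> simp only <;> linarith
    · obtain ⟨α, g0, g1, e, k1, k2, k3⟩ := key a h (by linarith)
      refine ⟨(a - 1/2, b - 1/2, c, d), ⟨⟨by simp only; linarith, by simp only; linarith,
        by simp only; linarith, by simp only; linarith⟩,
        Or.inl ⟨α, a - 1/2, b - a, c, d + (b - a), g0, g1, e,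
          ⟨hc, by simp only; linarith, ?_, ?_, ?_⟩, by linarith, by linarith, ?_⟩⟩, ?_⟩
      · simp only; linarith
      · simp only; linarith
      · simp only; linarith
      · ext <;> simp only <;> ring
      · refine ⟨?_, ?_, ?_, ?_, ?_, ?_, ?_, ?_⟩ <;> simp only <;> linarith
  · rcases le_or_gt b (1/2) with h | h
    · refine ⟨(a, 0, c, d), ⟨⟨ha, le_rfl, ha2, by simp only; linarith⟩,
        Or.inr ⟨0, 0, a, c + a, d, le_rfl, zero_le_one, by simp,
          ⟨by simp only; linarith, hd, ?_, ?_, ?_⟩, ha, by linarith, by simp⟩⟩, ?_⟩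
      · simp only; linarith
      · simp only; linarith
      · simp only; linarith
      · refine ⟨?_, ?_, ?_, ?_, ?_, ?_, ?_, ?_⟩ <;> simp only <;> linarith
    · obtain ⟨α, g0, g1, e, k1, k2, k3⟩ := key b h (by linarith)
      refine ⟨(a - 1/2, b - 1/2, c, d), ⟨⟨by simp only; linarith, by simp only; linarith,
        by simp only; linarith, by simp only; linarith⟩,
        Or.inr ⟨α, b - 1/2, a - b, c + (a - b), d, g0, g1, e,
          ⟨by simp only; linarith, hd, ?_, ?_, ?_⟩, by linarith, by linarith, ?_⟩⟩, ?_⟩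
      · simp only; linarith
      · simp only; linarith
      · simp only; linarith
      · ext <;> simp only <;> ring
      · refine ⟨?_, ?_, ?_, ?_, ?_, ?_, ?_, ?_⟩ <;> simp only <;> linarith
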